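/- arXiv:2008.07567 — 3 statements merged into one kernel-verified Lean document; each statement's English description precedes it below -/
import Mathlib

section
/- Let N ≥ 1 and let d be a divisor of N such that N/d is odd. A tuple λ : Fin d → ℕ is an admissible d-tuple if and only if the N-tuple λ^{N/d} obtained by concatenating N/d copies of λ (i.e., (λ^{N/d})_k = λ_{k mod d}) is an admissible N-tuple. -/
/-- An admissible `m`-tuple: `λ : Fin m → ℕ` with `∑ (λᵢ + 1) = 2m` and every consecutive
sum `∑_{k=i}^{j} (λₖ + 1) ≠ m` for `i ≤ j`. -/
def Admissible (m : ℕ) (lam : Fin m → ℕ) : Prop :=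
  (∑ i, (lam i + 1)) = 2 * m ∧
  ∀ i j : Fin m, i ≤ j → (∑ k ∈ Finset.Icc i j, (lam k + 1)) ≠ m

/-- Admissibility in terms of the partial sums of a sequence extending `k ↦ λₖ + 1`. -/
theorem admissible_iff_sum_range {m : ℕ} {lam : Fin m → ℕ} {a : ℕ → ℕ}
    (ha : ∀ k : Fin m, lam k + 1 = a k) :
    Admissible m lam ↔ ∑ k ∈ Finset.range m, a k = 2 * m ∧
      ∀ i j, i < j → j ≤ m →
        ∑ k ∈ Finset.range j, a k ≠ ∑ k ∈ Finset.range i, a k + m := by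
  have hIcc (i j : Fin m) (hij : i ≤ j) :
      ∑ k ∈ Finset.range i, a k + ∑ k ∈ Finset.Icc i j, (lam k + 1) =
        ∑ k ∈ Finset.range (j + 1), a k := by
    have h : ∑ k ∈ Finset.Icc i j, (lam k + 1) = ∑ k ∈ Finset.Ico (i : ℕ) (j + 1), a k := by
      rw [show Finset.Ico (i : ℕ) (j + 1) = (Finset.Icc i j).map Fin.valEmbedding by
        rw [Fin.map_valEmbedding_Icc]; ext; simp, Finset.sum_map]
      exact Finset.sum_congr rfl fun k _ => ha k
    rw [h]
    exact Finset.sum_range_add_sum_Ico a (Nat.le_succ_of_le hij)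
  unfold Admissible
  rw [Finset.sum_congr rfl fun k _ => ha k, Fin.sum_univ_eq_sum_range a m]
  refine and_congr_right fun _ => ⟨fun h i j hij hj heq => ?_, fun h i j hij heq => ?_⟩
  · have hle : (⟨i, by omega⟩ : Fin m) ≤ ⟨j - 1, by omega⟩ := Fin.mk_le_mk.2 (by omega)
    have hs := hIcc _ _ hle
    rw [Nat.sub_add_cancel (by omega : 1 ≤ j)] at hs
    exact h _ _ hle (by simp only at hs; omega)
  · exact h i (j + 1) (Nat.lt_succ_of_le hij) j.isLt (by rw [← hIcc i j hij, heq])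

/-- Shifting by `s` periods adds `s` times the sum over one period to a partial sum. -/
theorem sum_range_add_mul_of_periodic {a : ℕ → ℕ} {d : ℕ} (ha : Function.Periodic a d)
    (n s : ℕ) : ∑ k ∈ Finset.range (n + s * d), a k =
      ∑ k ∈ Finset.range n, a k + s * ∑ k ∈ Finset.range d, a k := by
  have hone (n : ℕ) : ∑ k ∈ Finset.range (n + d), a k =
      ∑ k ∈ Finset.range n, a k + ∑ k ∈ Finset.range d, a k := by
    rw [add_comm n d, Finset.sum_range_add, add_comm]
    congr 1
    exact Finset.sum_congr rfl fun k _ => by rw [add_comm d k, ha k]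
  induction s with
  | zero => simp
  | succ s ih => rw [Nat.succ_mul, ← add_assoc, hone, ih]; ring

/-- for `d ∣ N` with `N/d` odd, a `d`-tuple `λ` is admissible iff the
`N`-tuple obtained by concatenating `N/d` copies of `λ` (i.e. `k ↦ λ_{k mod d}`) is
an admissible `N`-tuple. -/
theorem admissible_iff_concat_admissible (N d : ℕ) (hN : 1 ≤ N) (hd : d ∣ N)
    (hodd : Odd (N / d)) (lam : Fin d → ℕ) :
    Admissible d lam ↔
      Admissible N (fun k : Fin N =>
        lam ⟨(k : ℕ) % d,
          Nat.mod_lt _ (Nat.pos_of_dvd_of_pos hd (Nat.zero_lt_of_lt k.isLt))⟩) := by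
  have hd0 : 0 < d := Nat.pos_of_dvd_of_pos hd hN
  obtain ⟨r, hr⟩ := hodd
  have hNd : N = (2 * r + 1) * d := by rw [← hr, Nat.div_mul_cancel hd]
  let a : ℕ → ℕ := fun k => lam ⟨k % d, Nat.mod_lt _ hd0⟩ + 1
  have hper : Function.Periodic a d := fun k => by simp [a]
  rw [admissible_iff_sum_range (a := a) fun k => by simp [a, Nat.mod_eq_of_lt k.isLt],
    admissible_iff_sum_range (a := a) fun k => rfl]
  have hshift := sum_range_add_mul_of_periodic hper
  have hmono : StrictMono fun n => ∑ k ∈ Finset.range n, a k :=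
    strictMono_nat_of_lt_succ fun n => by simp [Finset.sum_range_succ, a]
  have hlt (m n : ℕ) : ∑ k ∈ Finset.range m, a k < ∑ k ∈ Finset.range n, a k ↔ m < n :=
    hmono.lt_iff_lt
  have hzero : ∑ k ∈ Finset.range 0, a k = 0 := Finset.sum_range_zero a
  clear_value a
  have htotal : ∑ k ∈ Finset.range N, a k = 2 * N ↔ ∑ k ∈ Finset.range d, a k = 2 * d := by
    have h := hshift 0 (2 * r + 1)
    rw [zero_add, hzero, zero_add, ← hNd] at h
    rw [h, hNd, Nat.mul_left_comm 2]
    exact Nat.mul_right_inj (Nat.succ_ne_zero _)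
  rw [htotal]
  refine and_congr_right fun hsum => ?_
  rw [hsum] at hshift
  constructor
  · intro h i j hij hj heq
    have h1 := hshift i r
    have h2 : ∑ k ∈ Finset.range j, a k = ∑ k ∈ Finset.range (i + r * d), a k + d := by
      rw [heq, h1, hNd]; ring
    obtain ⟨i₀, s, hi₀, his⟩ : ∃ i₀ s, i₀ < d ∧ i + r * d = i₀ + s * d :=
      ⟨(i + r * d) % d, (i + r * d) / d, Nat.mod_lt _ hd0, by rw [Nat.mod_add_div']⟩
    rw [his] at h2
    have h3 : i₀ + s * d < j := (hlt _ _).1 (by omega)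
    obtain ⟨j₀, rfl⟩ : ∃ j₀, j = j₀ + s * d := ⟨j - s * d, by omega⟩
    rw [hshift, hshift] at h2
    rcases Nat.lt_or_ge d j₀ with hj₀ | hj₀
    · obtain ⟨j₁, rfl⟩ : ∃ j₁, j₀ = j₁ + 1 * d := ⟨j₀ - d, by omega⟩
      rw [hshift j₁ 1] at h2
      exact h j₁ i₀ ((hlt _ _).1 (by omega)) hi₀.le (by omega)
    · exact h i₀ j₀ (by omega) hj₀ (by omega)
  · intro h i j hij hj heq
    refine h i (j + r * d) (by omega) ?_ ?_
    · rw [hNd]; nlinarith [Nat.zero_le (r * d)]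
    · rw [hshift, heq, hNd]; ring
end

section
/- Let N ≥ 1 and let d be a divisor of N such that N/d is odd. Then the number of admissible N-tuples whose minimal period is exactly d equals the number of admissible d-tuples whose minimal period is exactly d; in the paper's notation, A_d^{(N)} = A_d^{(d)}. -/
/-- `λ` is `d`-periodic: `λ_{(k+d) mod m} = λ_k` for all `k`. -/
def IsPeriodic (m d : ℕ) (lam : Fin m → ℕ) : Prop :=
  ∀ k : Fin m, lam ⟨((k : ℕ) + d) % m, Nat.mod_lt _ (Nat.zero_lt_of_lt k.isLt)⟩ = lam k

/-- The minimal period of `λ` is exactly `d`: `d` is the least `d ≥ 1` for which `λ` is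
`d`-periodic. -/
def IsMinimalPeriod (m d : ℕ) (lam : Fin m → ℕ) : Prop :=
  1 ≤ d ∧ IsPeriodic m d lam ∧ ∀ e : ℕ, 1 ≤ e → IsPeriodic m e lam → d ≤ e

/-- The sum of the first `n` values of `k ↦ f k + 1`. -/
def prefixSum (f : ℕ → ℕ) (n : ℕ) : ℕ := ∑ k ∈ Finset.range n, (f k + 1)

theorem prefixSum_strictMono (f : ℕ → ℕ) : StrictMono (prefixSum f) :=
  strictMono_nat_of_lt_succ fun n => by
    simp only [prefixSum, Finset.sum_range_succ]
    omega

theorem prefixSum_add_period {f : ℕ → ℕ} {m : ℕ} (hf : Function.Periodic f m) (n : ℕ) :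
    prefixSum f (n + m) = prefixSum f n + prefixSum f m := by
  rw [add_comm n m, prefixSum, Finset.sum_range_add, add_comm]
  simp only [prefixSum, add_comm m, hf _]

theorem prefixSum_add_mul_period {f : ℕ → ℕ} {m : ℕ} (hf : Function.Periodic f m) (n q : ℕ) :
    prefixSum f (n + q * m) = prefixSum f n + q * prefixSum f m := by
  induction q with
  | zero => simp
  | succ q ih =>
    rw [Nat.succ_mul, ← add_assoc, prefixSum_add_period hf, ih, Nat.succ_mul, add_assoc]

theorem prefixSum_add_sum_Icc (f : ℕ → ℕ) {m : ℕ} {i j : Fin m} (hij : i ≤ j) :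
    prefixSum f i + ∑ k ∈ Finset.Icc i j, (f k + 1) = prefixSum f (j + 1) := by
  have h : ∑ k ∈ Finset.Icc i j, (f k + 1) = ∑ k ∈ Finset.Ico (i : ℕ) (j + 1), (f k + 1) := by
    rw [Finset.Ico_add_one_right_eq_Icc, ← Fin.map_valEmbedding_Icc, Finset.sum_map]
    rfl
  have hle : (i : ℕ) ≤ j + 1 := Nat.le_succ_of_le hij
  rw [h, prefixSum, prefixSum, Finset.range_eq_Ico, Finset.range_eq_Ico,
    Finset.sum_Ico_consecutive _ (Nat.zero_le _) hle]

/-- For a periodic sequence, admissibility of one period is a condition on all consecutive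
sums of the whole sequence. -/
theorem admissible_iff_prefixSum {f : ℕ → ℕ} {m : ℕ} (hm : 0 < m) (hf : Function.Periodic f m) :
    Admissible m (fun k => f k) ↔
      prefixSum f m = 2 * m ∧ ∀ i j, prefixSum f j ≠ prefixSum f i + m := by
  have hsum : ∑ i : Fin m, (f i + 1) = prefixSum f m :=
    Fin.sum_univ_eq_sum_range (fun k => f k + 1) m
  rw [Admissible, hsum]
  refine and_congr_right fun hS => ⟨fun h i j hij => ?_, fun h i j hij hs => ?_⟩
  · have mono := prefixSum_strictMono f
    have lin : ∀ i j, j ≤ m → prefixSum f j ≠ prefixSum f i + m := by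
      intro i j hj hij
      have hlt : i < j := mono.lt_iff_lt.1 (by omega)
      have hle : (⟨i, by omega⟩ : Fin m) ≤ ⟨j - 1, by omega⟩ := Fin.mk_le_mk.2 (by omega)
      have key := prefixSum_add_sum_Icc f hle
      have hj1 : j - 1 + 1 = j := by omega
      simp only [hj1] at key
      exact h _ _ hle (by omega)
    have step : ∀ i j, i < m → prefixSum f j ≠ prefixSum f i + m := by
      intro i j hi hij
      by_cases hj : j ≤ m
      · exact lin i j hj hij
      · have hp := prefixSum_add_period hf (j - m)
        rw [Nat.sub_add_cancel (by omega)] at hp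
        exact lin (j - m) i hi.le (by omega)
    have hlt : i < j := mono.lt_iff_lt.1 (by omega)
    have hdiv := Nat.mod_add_div' i m
    have hi := prefixSum_add_mul_period hf (i % m) (i / m)
    have hj := prefixSum_add_mul_period hf (j - i / m * m) (i / m)
    rw [hdiv] at hi
    rw [Nat.sub_add_cancel (by omega)] at hj
    exact step (i % m) (j - i / m * m) (Nat.mod_lt _ hm) (by omega)
  · have key := prefixSum_add_sum_Icc f hij
    exact h i (j + 1) (by omega)

/-- The `prefixSum` conditions for a period `d` and for an odd multiple of it are equivalent. -/
theorem prefixSum_conditions_mul_odd {f : ℕ → ℕ} {d q : ℕ} (hq : Odd q)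
    (hf : Function.Periodic f d) :
    (prefixSum f (q * d) = 2 * (q * d) ∧ ∀ i j, prefixSum f j ≠ prefixSum f i + q * d) ↔
      prefixSum f d = 2 * d ∧ ∀ i j, prefixSum f j ≠ prefixSum f i + d := by
  have h0 : prefixSum f (q * d) = q * prefixSum f d := by
    simpa [prefixSum] using prefixSum_add_mul_period hf 0 q
  have h1 : prefixSum f (q * d) = 2 * (q * d) ↔ prefixSum f d = 2 * d := by
    rw [h0, mul_left_comm 2 q d]
    exact Nat.mul_right_inj hq.pos.ne'
  rw [h1]
  refine and_congr_right fun hS => ?_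
  obtain ⟨t, rfl⟩ := hq
  have hN : (2 * t + 1) * d = d + t * prefixSum f d := by rw [hS]; ring
  rw [hN]
  refine ⟨fun h i j hij => h i (j + t * d) ?_, fun h i j hij => h i (j - t * d) ?_⟩
  · rw [prefixSum_add_mul_period hf]
    omega
  · have hi := prefixSum_add_mul_period hf i t
    have hle : i + t * d ≤ j := (prefixSum_strictMono f).le_iff_le.1 (by omega)
    have hj := prefixSum_add_mul_period hf (j - t * d) t
    rw [Nat.sub_add_cancel (by omega)] at hj
    omega

theorem isPeriodic_iff_periodic {f : ℕ → ℕ} {m : ℕ} (hm : 0 < m) (hf : Function.Periodic f m)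
    (e : ℕ) : IsPeriodic m e (fun k => f k) ↔ Function.Periodic f e := by
  simp only [IsPeriodic, hf.map_mod_nat]
  refine ⟨fun h k => ?_, fun h k => h k⟩
  have := h ⟨k % m, Nat.mod_lt _ hm⟩
  simpa only [hf.map_mod_nat, ← hf.map_mod_nat (k % m + e), Nat.mod_add_mod] using this

/-- Admissible `q * d`-tuples of minimal period `d`, with `q` odd, correspond to sequences
characterised by conditions that do not involve `q`. -/
theorem card_admissible_mul_odd {d q : ℕ} (hd : 0 < d) (hq : Odd q) :
    Nat.card {lam : Fin (q * d) → ℕ // Admissible (q * d) lam ∧ IsMinimalPeriod (q * d) d lam} =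
      Nat.card {f : ℕ → ℕ // Function.Periodic f d ∧
        (prefixSum f d = 2 * d ∧ ∀ i j, prefixSum f j ≠ prefixSum f i + d) ∧
        ∀ e, 1 ≤ e → Function.Periodic f e → d ≤ e} := by
  have hm : 0 < q * d := Nat.mul_pos hq.pos hd
  have hiff : ∀ f : ℕ → ℕ, Function.Periodic f (q * d) →
      ((Admissible (q * d) (fun k => f k) ∧ IsMinimalPeriod (q * d) d (fun k => f k)) ↔
        Function.Periodic f d ∧
        (prefixSum f d = 2 * d ∧ ∀ i j, prefixSum f j ≠ prefixSum f i + d) ∧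
        ∀ e, 1 ≤ e → Function.Periodic f e → d ≤ e) := by
    intro f hf
    rw [admissible_iff_prefixSum hm hf, IsMinimalPeriod]
    simp only [isPeriodic_iff_periodic hm hf]
    constructor
    · rintro ⟨hA, -, hp, hmin⟩
      exact ⟨hp, (prefixSum_conditions_mul_odd hq hp).1 hA, hmin⟩
    · rintro ⟨hp, hA, hmin⟩
      exact ⟨(prefixSum_conditions_mul_odd hq hp).2 hA, hd, hp, hmin⟩
  have hper : ∀ f : ℕ → ℕ, Function.Periodic f d → Function.Periodic f (q * d) :=
    fun f hf => by simpa using hf.nat_mul q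
  symm
  refine Nat.card_eq_of_bijective
    (fun f => ⟨fun k => f.1 k, (hiff f.1 (hper _ f.2.1)).2 f.2⟩) ⟨?_, ?_⟩
  · rintro ⟨f, hf⟩ ⟨g, hg⟩ hfg
    refine Subtype.ext (funext fun k => ?_)
    have := congrFun (congrArg Subtype.val hfg) ⟨k % (q * d), Nat.mod_lt _ hm⟩
    simpa only [(hper _ hf.1).map_mod_nat, (hper _ hg.1).map_mod_nat] using this
  · rintro ⟨lam, hlam⟩
    let f : ℕ → ℕ := fun k => lam ⟨k % (q * d), Nat.mod_lt _ hm⟩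
    have hf : Function.Periodic f (q * d) := fun k => by simp only [f, Nat.add_mod_right]
    have hres : (fun k : Fin (q * d) => f k) = lam :=
      funext fun k => by simp only [f, Nat.mod_eq_of_lt k.isLt]
    exact ⟨⟨f, (hiff f hf).1 (by rwa [hres])⟩, Subtype.ext hres⟩

/-- for `d ∣ N` with `N/d` odd, the number of admissible `N`-tuples of
minimal period exactly `d` equals the number of admissible `d`-tuples of minimal period
exactly `d` (in the paper's notation, `A_d^{(N)} = A_d^{(d)}`). -/
theorem card_minimal_period_eq (N d : ℕ) (hN : 1 ≤ N) (hd : d ∣ N)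
    (hodd : Odd (N / d)) :
    Nat.card {lam : Fin N → ℕ // Admissible N lam ∧ IsMinimalPeriod N d lam}
      = Nat.card {lam : Fin d → ℕ // Admissible d lam ∧ IsMinimalPeriod d d lam} := by
  have hpos : 0 < d := Nat.pos_of_dvd_of_pos hd hN
  have hNd := card_admissible_mul_odd hpos hodd
  have hdd := card_admissible_mul_odd hpos odd_one
  rw [Nat.div_mul_cancel hd] at hNd
  rw [one_mul] at hdd
  exact hNd.trans hdd.symm
end

section
/- For every integer N ≥ 1, the sum of A_{N/d} over the odd divisors d of N equals 2^{N−1}: ∑_{d ∣ N, d odd} A_{N/d} = 2^{N−1}. -/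
/-- `λ` is aperiodic: the only `d` with `1 ≤ d ≤ m` for which `λ` is `d`-periodic is
`d = m`. -/
def Aperiodic (m : ℕ) (lam : Fin m → ℕ) : Prop :=
  ∀ d : ℕ, 1 ≤ d → d ≤ m → IsPeriodic m d lam → d = m

/-- `A m` is the number of aperiodic admissible `m`-tuples. -/
noncomputable def numAperiodic (m : ℕ) : ℕ :=
  Nat.card {lam : Fin m → ℕ // Admissible m lam ∧ Aperiodic m lam}

/-- The partial sums `∑_{k < i} (a k + 1)`. -/
def partialSum (a : ℕ → ℕ) (i : ℕ) : ℕ := ∑ k ∈ Finset.range i, (a k + 1)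

/-- Admissibility of an infinite sequence, in terms of its partial sums. -/
def SeqAdmissible (m : ℕ) (a : ℕ → ℕ) : Prop :=
  (∀ i, partialSum a (i + m) = partialSum a i + 2 * m) ∧
  ∀ i j, partialSum a j ≠ partialSum a i + m

/-- No positive period of `a` is at most `m`, except possibly `m`. -/
def SeqAperiodic (m : ℕ) (a : ℕ → ℕ) : Prop :=
  ∀ d : ℕ, 1 ≤ d → d ≤ m → Function.Periodic a d → d = m

@[simp] lemma partialSum_zero (a : ℕ → ℕ) : partialSum a 0 = 0 := by simp [partialSum]

lemma partialSum_succ (a : ℕ → ℕ) (i : ℕ) :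
    partialSum a (i + 1) = partialSum a i + (a i + 1) := by
  simp [partialSum, Finset.sum_range_succ]

lemma partialSum_strictMono (a : ℕ → ℕ) : StrictMono (partialSum a) :=
  strictMono_nat_of_lt_succ fun i => by rw [partialSum_succ]; omega

lemma partialSum_injective : Function.Injective partialSum := fun a b h => by
  funext i
  have h0 := congrFun h i
  have h1 := congrFun h (i + 1)
  rw [partialSum_succ, partialSum_succ] at h1
  omega

lemma partialSum_add_sum_Ico (a : ℕ → ℕ) {i j : ℕ} (h : i ≤ j) :
    partialSum a i + ∑ k ∈ Finset.Ico i j, (a k + 1) = partialSum a j :=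
  Finset.sum_range_add_sum_Ico _ h

lemma partialSum_add_of_periodic {a : ℕ → ℕ} {p : ℕ} (h : Function.Periodic a p) (i : ℕ) :
    partialSum a (i + p) = partialSum a i + partialSum a p := by
  induction i with
  | zero => simp
  | succ i ih =>
    rw [show i + 1 + p = i + p + 1 by ring, partialSum_succ, partialSum_succ, ih, h]
    ring

lemma partialSum_add_mul {a : ℕ → ℕ} {p c : ℕ}
    (h : ∀ i, partialSum a (i + p) = partialSum a i + c) (i q : ℕ) :
    partialSum a (i + q * p) = partialSum a i + q * c := by
  induction q with
  | zero => simp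
  | succ q ih => rw [show i + (q + 1) * p = i + q * p + p by ring, h, ih]; ring

lemma SeqAdmissible.periodic {m : ℕ} {a : ℕ → ℕ} (h : SeqAdmissible m a) :
    Function.Periodic a m := fun i => by
  have h0 := h.1 i
  have h1 := h.1 (i + 1)
  rw [show i + 1 + m = i + m + 1 by ring, partialSum_succ, partialSum_succ] at h1
  omega

lemma SeqAdmissible.odd_mul {m d : ℕ} {a : ℕ → ℕ} (h : SeqAdmissible m a) (hd : Odd d) :
    SeqAdmissible (d * m) a := by
  refine ⟨fun i => by rw [partialSum_add_mul h.1]; ring, fun i j hij => ?_⟩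
  obtain ⟨c, rfl⟩ := hd
  apply h.2 (i + c * m) j
  rw [hij, partialSum_add_mul h.1]
  ring

lemma SeqAdmissible.of_periodic {p q : ℕ} {a : ℕ → ℕ} (h : SeqAdmissible (q * p) a)
    (hq : 0 < q) (hp : Function.Periodic a p) : Odd q ∧ SeqAdmissible p a := by
  have hs := partialSum_add_of_periodic hp
  have hsum : partialSum a p = 2 * p := by
    have h1 := partialSum_add_mul hs 0 q
    have h2 := h.1 0
    rw [h1] at h2
    apply Nat.eq_of_mul_eq_mul_left hq
    linarith
  rw [hsum] at hs
  have hodd : Odd q := by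
    by_contra hev
    obtain ⟨c, rfl⟩ := Nat.not_odd_iff_even.1 hev
    apply h.2 0 (0 + c * p)
    rw [partialSum_add_mul hs]
    ring
  refine ⟨hodd, hs, fun i j hij => ?_⟩
  obtain ⟨c, rfl⟩ := hodd
  apply h.2 i (j + c * p)
  rw [partialSum_add_mul hs, hij]
  ring

lemma exists_minimal_period {N : ℕ} (hN : 0 < N) {a : ℕ → ℕ} (h : Function.Periodic a N) :
    ∃ p, 0 < p ∧ p ∣ N ∧ Function.Periodic a p ∧ SeqAperiodic p a := by
  classical
  have hex : ∃ p, 0 < p ∧ Function.Periodic a p := ⟨N, hN, h⟩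
  obtain ⟨hp0, hp⟩ := Nat.find_spec hex
  have hmin : ∀ d, 0 < d → Function.Periodic a d → Nat.find hex ≤ d :=
    fun d hd hper => Nat.find_min' hex ⟨hd, hper⟩
  generalize Nat.find hex = p at *
  refine ⟨p, hp0, ?_, hp, fun d hd hle hper => le_antisymm hle (hmin d hd hper)⟩
  rw [Nat.dvd_iff_mod_eq_zero]
  by_contra hne
  have hmod : Function.Periodic a (N % p) := fun x => by
    have h1 := hp.nat_mul (N / p) (x + N % p)
    have h2 := h x
    rw [← Nat.mod_add_div' N p, ← add_assoc] at h2
    simpa [h2] using h1.symm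
  exact absurd (hmin _ (Nat.pos_of_ne_zero hne) hmod) (not_le.2 (Nat.mod_lt _ hp0))

/-- The `m`-periodic extension of an `m`-tuple. -/
def periodicExtension (m : ℕ) [NeZero m] (lam : Fin m → ℕ) (k : ℕ) : ℕ := lam (Fin.ofNat m k)

section PeriodicExtension

variable {m : ℕ} [NeZero m]

lemma periodicExtension_val (lam : Fin m → ℕ) (k : Fin m) :
    periodicExtension m lam k = lam k := by
  simp [periodicExtension]

lemma periodicExtension_injective : Function.Injective (periodicExtension m) := fun f g h => by
  funext k
  rw [← periodicExtension_val f, ← periodicExtension_val g, h]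

lemma periodicExtension_restrict {a : ℕ → ℕ} (h : Function.Periodic a m) :
    periodicExtension m (fun k => a k) = a := by
  funext k
  simpa [periodicExtension] using h.map_mod_nat k

lemma periodicExtension_periodic (lam : Fin m → ℕ) :
    Function.Periodic (periodicExtension m lam) m := fun k => by
  simp [periodicExtension, Fin.ofNat]

lemma periodic_periodicExtension_iff (lam : Fin m → ℕ) (d : ℕ) :
    Function.Periodic (periodicExtension m lam) d ↔ IsPeriodic m d lam := by
  constructor
  · intro h k
    rw [← periodicExtension_val lam k, ← h k]
    rfl
  · intro h k
    have := h (Fin.ofNat m k)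
    simpa [periodicExtension, Fin.ofNat] using this

lemma seqAperiodic_periodicExtension_iff (lam : Fin m → ℕ) :
    SeqAperiodic m (periodicExtension m lam) ↔ Aperiodic m lam := by
  simp only [SeqAperiodic, Aperiodic, periodic_periodicExtension_iff]

lemma partialSum_periodicExtension (lam : Fin m → ℕ) :
    partialSum (periodicExtension m lam) m = ∑ i, (lam i + 1) := by
  simp [partialSum, Finset.sum_range, periodicExtension_val]

lemma partialSum_add_sum_Icc (lam : Fin m → ℕ) {i j : Fin m} (h : i ≤ j) :
    partialSum (periodicExtension m lam) i + ∑ k ∈ Finset.Icc i j, (lam k + 1) =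
      partialSum (periodicExtension m lam) (j + 1) := by
  rw [← partialSum_add_sum_Ico _ (Nat.le_succ_of_le (Fin.le_def.1 h))]
  congr 1
  have : Finset.Ico (i : ℕ) ((j : ℕ) + 1) = (Finset.Icc i j).map Fin.valEmbedding := by
    rw [Fin.map_valEmbedding_Icc]
    ext
    simp
  rw [this, Finset.sum_map]
  simp [periodicExtension_val]

lemma Admissible.partialSum_ne {lam : Fin m → ℕ} (h : Admissible m lam) {i j : ℕ} (hj : j ≤ m) :
    partialSum (periodicExtension m lam) j ≠ partialSum (periodicExtension m lam) i + m := by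
  intro hij
  have hlt : i < j := (partialSum_strictMono (periodicExtension m lam)).lt_iff_lt.1 (by
    have := NeZero.pos m
    omega)
  have hle : (⟨i, by omega⟩ : Fin m) ≤ ⟨j - 1, by omega⟩ := Fin.le_def.2 (by simp; omega)
  have hsum := partialSum_add_sum_Icc lam hle
  simp only [Nat.sub_add_cancel (show 1 ≤ j by omega)] at hsum
  exact h.2 _ _ hle (by omega)

lemma seqAdmissible_periodicExtension_iff (lam : Fin m → ℕ) :
    SeqAdmissible m (periodicExtension m lam) ↔ Admissible m lam := by
  constructor
  · intro h
    refine ⟨?_, fun i j hij hsum => ?_⟩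
    · rw [← partialSum_periodicExtension]
      simpa using h.1 0
    · apply h.2 i (j + 1)
      rw [← partialSum_add_sum_Icc lam hij, hsum]
  · intro h
    have hs := partialSum_add_of_periodic (periodicExtension_periodic lam)
    rw [partialSum_periodicExtension, h.1] at hs
    refine ⟨hs, fun i j hij => ?_⟩
    have hmono := partialSum_strictMono (periodicExtension m lam)
    have hm := NeZero.pos m
    have hlt : i < j := hmono.lt_iff_lt.1 (by omega)
    have hi := Nat.mod_add_div' i m
    have hi' := Nat.mod_lt i hm
    obtain ⟨r, hr⟩ : ∃ r, j = r + i / m * m := ⟨j - i / m * m, by omega⟩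
    have hsi := partialSum_add_mul hs (i % m) (i / m)
    have hsj := partialSum_add_mul hs r (i / m)
    rw [hi] at hsi
    rw [← hr] at hsj
    rcases le_or_gt r m with hrm | hrm
    · exact h.partialSum_ne (i := i % m) hrm (by omega)
    · have := hs (r - m)
      rw [Nat.sub_add_cancel hrm.le] at this
      exact h.partialSum_ne (i := r - m) hi'.le (by omega)

end PeriodicExtension

lemma numAperiodic_eq_ncard {m : ℕ} (hm : 0 < m) :
    numAperiodic m = {a | SeqAdmissible m a ∧ SeqAperiodic m a}.ncard := by
  have : NeZero m := ⟨hm.ne'⟩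
  have himage : {a | SeqAdmissible m a ∧ SeqAperiodic m a} =
      periodicExtension m '' {lam | Admissible m lam ∧ Aperiodic m lam} := by
    ext a
    constructor
    · rintro ⟨h1, h2⟩
      have ha := periodicExtension_restrict h1.periodic
      refine ⟨_, ⟨?_, ?_⟩, ha⟩
      · rwa [← seqAdmissible_periodicExtension_iff, ha]
      · rwa [← seqAperiodic_periodicExtension_iff, ha]
    · rintro ⟨lam, ⟨h1, h2⟩, rfl⟩
      exact ⟨(seqAdmissible_periodicExtension_iff lam).2 h1,
        (seqAperiodic_periodicExtension_iff lam).2 h2⟩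
  rw [himage, Set.ncard_image_of_injective _ periodicExtension_injective]
  rfl

lemma Nat.ModEq.eq_add_of_lt_of_lt {n x y : ℕ} (h : x ≡ y [MOD n]) (hxy : x < y)
    (hy : y < x + 2 * n) : y = x + n := by
  obtain ⟨c, hc⟩ := (Nat.modEq_iff_dvd' hxy.le).1 h
  have hc0 : 0 < c := Nat.pos_of_ne_zero (by rintro rfl; omega)
  have hc2 : c < 2 := Nat.lt_of_mul_lt_mul_left (a := n) (by omega)
  obtain rfl : c = 1 := by omega
  omega

lemma SeqAdmissible.mem_range_add_iff {N : ℕ} (hN : 0 < N) {a : ℕ → ℕ} (h : SeqAdmissible N a)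
    (x : ℕ) : x + N ∈ Set.range (partialSum a) ↔ x ∉ Set.range (partialSum a) := by
  constructor
  · rintro ⟨j, hj⟩ ⟨i, rfl⟩
    exact h.2 i j hj
  · intro hx
    have : NeZero N := ⟨hN.ne'⟩
    have hmono := partialSum_strictMono a
    have hsN : partialSum a N = 2 * N := by simpa using h.1 0
    have hlt : ∀ k : Fin N, partialSum a k < 2 * N := fun k => hsN ▸ hmono k.isLt
    have hinj : Function.Injective fun k : Fin N => (partialSum a k : ZMod N) := by
      have hwlog : ∀ k l : Fin N, k < l → (partialSum a k : ZMod N) ≠ partialSum a l := by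
        intro k l hkl heq
        have h1 := hmono (Fin.lt_def.1 hkl)
        have h2 := hlt l
        exact h.2 k l
          (((ZMod.natCast_eq_natCast_iff _ _ _).1 heq).eq_add_of_lt_of_lt h1 (by omega))
      intro k l hkl
      rcases lt_trichotomy k l with hlt' | heq | hlt'
      · exact absurd hkl (hwlog k l hlt')
      · exact heq
      · exact absurd hkl.symm (hwlog l k hlt')
    obtain ⟨k, hk⟩ := ((Fintype.bijective_iff_injective_and_card _).2
      ⟨hinj, by simp [ZMod.card]⟩).2 (x : ZMod N)
    have hmod := (ZMod.natCast_eq_natCast_iff _ _ _).1 hk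
    rcases le_or_gt (partialSum a k) x with hle | hgt
    · obtain ⟨c, hc⟩ := (Nat.modEq_iff_dvd' hle).1 hmod
      rcases Nat.even_or_odd' c with ⟨e, rfl | rfl⟩
      · refine absurd ⟨k + e * N, ?_⟩ hx
        rw [partialSum_add_mul h.1]
        have : N * (2 * e) = e * (2 * N) := by ring
        omega
      · refine ⟨k + (e + 1) * N, ?_⟩
        rw [partialSum_add_mul h.1]
        have : N * (2 * e + 1) + N = (e + 1) * (2 * N) := by ring
        omega
    · have h2 := hlt k
      exact ⟨k, hmod.symm.eq_add_of_lt_of_lt hgt (by omega)⟩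

/-- An antiperiodic predicate true at `0` is the set of partial sums of an admissible sequence. -/
lemma exists_seqAdmissible_of_antiperiodic {N : ℕ} (hN : 0 < N) {P : ℕ → Prop} (h0 : P 0)
    (hP : ∀ x, P (x + N) ↔ ¬ P x) :
    ∃ a, SeqAdmissible N a ∧ ∀ x, x ∈ Set.range (partialSum a) ↔ P x := by
  classical
  have hP2 : ∀ x, P (x + 2 * N) ↔ P x := fun x => by
    rw [two_mul, ← add_assoc, hP, hP, not_not]
  have hP2' : ∀ q, P (q * (2 * N)) := fun q => by
    induction q with
    | zero => simpa using h0
    | succ q ih => rwa [add_mul, one_mul, hP2]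
  have hinf : {x | P x}.Infinite := Set.infinite_of_forall_exists_gt fun n =>
    ⟨(n + 1) * (2 * N), hP2' _, by nlinarith⟩
  have hcountN : Nat.count P (2 * N) = N := by
    rw [two_mul, Nat.count_add]
    simp only [add_comm N, hP]
    rw [Nat.count_eq_card_filter_range, Nat.count_eq_card_filter_range,
      Finset.card_filter_add_card_filter_not, Finset.card_range]
  have hcount : ∀ x, Nat.count P (x + 2 * N) = Nat.count P x + N := fun x => by
    rw [add_comm x, Nat.count_add, hcountN, add_comm]
    simp only [add_comm (2 * N), hP2]
  have hsmono : StrictMono (Nat.nth P) := Nat.nth_strictMono hinf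
  have hpartial : ∀ i, partialSum (fun k => Nat.nth P (k + 1) - Nat.nth P k - 1) i =
      Nat.nth P i := fun i => by
    induction i with
    | zero => simp [Nat.nth_zero_of_zero h0]
    | succ i ih =>
      have := hsmono (Nat.lt_succ_self i)
      rw [partialSum_succ, ih]
      simp only [Nat.succ_eq_add_one] at this
      omega
  refine ⟨fun k => Nat.nth P (k + 1) - Nat.nth P k - 1,
    ⟨fun i => ?_, fun i j hij => ?_⟩, fun x => ?_⟩
  · rw [hpartial, hpartial]
    have h1 := Nat.nth_count ((hP2 _).2 (Nat.nth_mem_of_infinite hinf i))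
    rwa [hcount, Nat.count_nth_of_infinite hinf] at h1
  · rw [hpartial, hpartial] at hij
    have h1 := Nat.nth_mem_of_infinite hinf j
    rw [hij, hP] at h1
    exact h1 (Nat.nth_mem_of_infinite hinf i)
  · simp only [Set.mem_range, hpartial]
    exact ⟨fun ⟨i, hi⟩ => hi ▸ Nat.nth_mem_of_infinite hinf i,
      fun hx => ⟨Nat.count P x, Nat.nth_count hx⟩⟩

lemma antiperiodic_iff_mod {N : ℕ} {P : ℕ → Prop} (hP : ∀ x, P (x + N) ↔ ¬ P x)
    (x : ℕ) : P x ↔ (Even (x / N) ↔ P (x % N)) := by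
  have key : ∀ q r, P (r + q * N) ↔ (Even q ↔ P r) := fun q r => by
    induction q with
    | zero => simp
    | succ q ih => rw [add_mul, one_mul, ← add_assoc, hP, ih, Nat.even_add_one]; tauto
  rw [← key, Nat.mod_add_div']

lemma ncard_seqAdmissible {N : ℕ} (hN : 0 < N) : {a | SeqAdmissible N a}.ncard = 2 ^ (N - 1) := by
  classical
  let Φ : (ℕ → ℕ) → Finset ℕ := fun a => (Finset.Ico 1 N).filter (· ∈ Set.range (partialSum a))
  have h0 : ∀ a, 0 ∈ Set.range (partialSum a) := fun a => ⟨0, partialSum_zero a⟩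
  have hinj : Set.InjOn Φ {a | SeqAdmissible N a} := by
    intro a ha b hb hab
    apply partialSum_injective
    rw [← (partialSum_strictMono a).range_inj (partialSum_strictMono b)]
    ext x
    rw [antiperiodic_iff_mod (P := (· ∈ Set.range (partialSum a))) (ha.mem_range_add_iff hN) x,
      antiperiodic_iff_mod (P := (· ∈ Set.range (partialSum b))) (hb.mem_range_add_iff hN) x]
    have hr := Nat.mod_lt x hN
    generalize x % N = r at *
    rcases Nat.eq_zero_or_pos r with rfl | hpos
    · simp only [h0]
    · have hmem := Finset.ext_iff.1 hab r
      simp only [Φ, Finset.mem_filter, Finset.mem_Ico, show 1 ≤ r from hpos, hr, and_self,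
        true_and] at hmem
      simp only [hmem]
  have himage : Φ '' {a | SeqAdmissible N a} = ((Finset.Ico 1 N).powerset : Set (Finset ℕ)) := by
    ext U
    simp only [Finset.coe_powerset, Set.mem_preimage, Set.mem_powerset_iff, Finset.coe_subset]
    constructor
    · rintro ⟨a, -, rfl⟩
      exact Finset.filter_subset _ _
    · intro hU
      obtain ⟨a, ha, hrange⟩ := exists_seqAdmissible_of_antiperiodic hN
        (P := fun x => Even (x / N) ↔ x % N ∈ insert 0 U) (by simp) (fun x => by
          rw [Nat.add_div_right x hN, Nat.add_mod_right, Nat.even_add_one]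
          tauto)
      refine ⟨a, ha, ?_⟩
      ext x
      simp only [Φ, Finset.mem_filter, hrange]
      constructor
      · rintro ⟨hx, hx'⟩
        rw [Finset.mem_Ico] at hx
        rw [Nat.div_eq_of_lt hx.2, Nat.mod_eq_of_lt hx.2] at hx'
        have := hx'.1 Even.zero
        rw [Finset.mem_insert] at this
        exact this.resolve_left (by omega)
      · intro hx
        have hx2 := (Finset.mem_Ico.1 (hU hx)).2
        exact ⟨hU hx, by simp [Nat.div_eq_of_lt hx2, Nat.mod_eq_of_lt hx2, hx]⟩
  rw [← hinj.ncard_image, himage, Set.ncard_coe_finset, Finset.card_powerset,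
    Nat.card_Ico]

lemma setOf_seqAdmissible_eq_biUnion {N : ℕ} (hN : 0 < N) :
    {a | SeqAdmissible N a} = ⋃ d ∈ N.divisors.filter (fun d => Odd d),
      {a | SeqAdmissible (N / d) a ∧ SeqAperiodic (N / d) a} := by
  ext a
  simp only [Set.mem_iUnion, Finset.mem_filter, Nat.mem_divisors, Set.mem_ofPred_eq, exists_prop]
  constructor
  · intro h
    obtain ⟨p, hp, ⟨q, rfl⟩, hper, hap⟩ := exists_minimal_period hN h.periodic
    rw [mul_comm] at h
    obtain ⟨hodd, hadm⟩ := h.of_periodic (Nat.pos_of_mul_pos_left hN) hper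
    refine ⟨q, ⟨⟨Dvd.intro_left p rfl, hN.ne'⟩, hodd⟩, ?_⟩
    rw [Nat.mul_div_cancel p (Nat.pos_of_mul_pos_left hN)]
    exact ⟨hadm, hap⟩
  · rintro ⟨d, ⟨⟨hd, -⟩, hodd⟩, hadm, -⟩
    have := hadm.odd_mul hodd
    rwa [Nat.mul_div_cancel' hd] at this

/-- `∑_{d ∣ N, d odd} A_{N/d} = 2^(N-1)`. -/
theorem sum_numAperiodic_over_odd_divisors (N : ℕ) (hN : 1 ≤ N) :
    ∑ d ∈ N.divisors.filter (fun d => Odd d), numAperiodic (N / d) = 2 ^ (N - 1) := by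
  have hpos : ∀ d ∈ N.divisors, 0 < N / d := fun d hd =>
    Nat.div_pos (Nat.divisor_le hd) (Nat.pos_of_mem_divisors hd)
  have hfin : ∀ {m : ℕ}, 0 < m → {a | SeqAdmissible m a ∧ SeqAperiodic m a}.Finite := fun hm =>
    (Set.finite_of_ncard_ne_zero
      ((ncard_seqAdmissible hm).trans_ne (pow_ne_zero _ two_ne_zero))).subset
      fun _ h => h.1
  rw [← ncard_seqAdmissible hN, setOf_seqAdmissible_eq_biUnion hN]
  have hdisj : ((N.divisors.filter (fun d => Odd d) : Finset ℕ) : Set ℕ).PairwiseDisjoint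
      fun d => {a | SeqAdmissible (N / d) a ∧ SeqAperiodic (N / d) a} := by
    intro d hd e he hde
    have hd' := (Finset.mem_filter.1 hd).1
    have he' := (Finset.mem_filter.1 he).1
    refine Set.disjoint_left.2 fun a h1 h2 => hde ?_
    have heq : N / d = N / e := by
      rcases le_total (N / d) (N / e) with hle | hle
      · exact h2.2 _ (hpos d hd') hle h1.1.periodic
      · exact (h1.2 _ (hpos e he') hle h2.1.periodic).symm
    exact (Nat.div_eq_iff_eq_of_dvd_dvd (by omega) (Nat.dvd_of_mem_divisors hd')
      (Nat.dvd_of_mem_divisors he')).1 heq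
  have hunion := (Finset.finite_toSet (N.divisors.filter (fun d => Odd d))).ncard_biUnion
    (fun d hd => hfin (hpos d (Finset.mem_filter.1 hd).1)) hdisj
  rw [finsum_mem_coe_finset] at hunion
  refine Eq.trans ?_ hunion.symm
  exact Finset.sum_congr rfl fun d hd => numAperiodic_eq_ncard (hpos d (Finset.mem_filter.1 hd).1)
end
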